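/- Let g ∈ ℕ, 1 ≤ k ≤ g, let v₁,…,vₖ ∈ ℂ^g, and set Vₕ = vₕ·ᵗvₕ (the rank-one symmetric g×g matrix with entries (vₕ)_a(vₕ)_b). Let A be the k×g matrix whose h-th row is ᵗvₕ. Then for all k-element subsets I and J = {j₁<⋯<jₖ} of {1,…,g}: Σ_{σ∈S_k} sgn(σ)·det( V₁(I,j_{σ(1)}) | ⋯ | Vₖ(I,j_{σ(k)}) ) = det(A_I)·det(A_J), where Vₕ(I,j) is the column vector of entries of Vₕ in rows I and column j, and A_I (resp. A_J) is the k×k submatrix of A with columns in I (resp. J). -/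

import Mathlib

open scoped BigOperators

/-- The `a`-th element (in increasing order) of a `k`-element subset `I` of `Fin g`. -/
def enum {g k : ℕ} (I : {s : Finset (Fin g) // s.card = k}) (a : Fin k) : Fin g :=
  (I.1.orderIsoOfFin I.2 a).1

/-- Scaling the columns of `B` by the entries of `C` along a permutation and taking the signed sum
of determinants over all permutations factors as a product of determinants. -/
theorem Matrix.sum_sign_mul_det_mul_row {n R : Type*} [Fintype n] [DecidableEq n] [CommRing R]
    (B C : Matrix n n R) :
    (∑ σ : Equiv.Perm n, ((Equiv.Perm.sign σ : ℤ) : R) *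
        (Matrix.of fun b a => C a (σ a) * B b a).det) = B.det * C.det := by
  rw [← Matrix.det_transpose C, Matrix.det_apply' C.transpose, Finset.mul_sum]
  refine Finset.sum_congr rfl fun σ _ => ?_
  rw [Matrix.det_mul_row (fun a => C a (σ a)) B]
  simp only [Matrix.transpose_apply]
  ring

/-- key identity in the proof of Lemma 2.3: for `Vₕ = vₕ·ᵗvₕ` and `A`
the `k×g` matrix with rows `ᵗvₕ`,
`Σ_{σ∈S_k} sgn(σ)·det( V₁(I,j_{σ(1)}) | ⋯ | Vₖ(I,j_{σ(k)}) ) = det(A_I)·det(A_J)`. -/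
theorem sum_perm_det_rank_one (g k : ℕ) (hk1 : 1 ≤ k) (hkg : k ≤ g)
    (v : Fin k → Fin g → ℂ)
    (I J : {s : Finset (Fin g) // s.card = k}) :
    (∑ σ : Equiv.Perm (Fin k), ((Equiv.Perm.sign σ : ℤ) : ℂ) *
        (Matrix.of fun b a : Fin k => v a (enum I b) * v a (enum J (σ a))).det) =
      (Matrix.of fun h a : Fin k => v h (enum I a)).det *
        (Matrix.of fun h a : Fin k => v h (enum J a)).det := by
  rw [← Matrix.det_transpose (Matrix.of fun h a : Fin k => v h (enum I a)),
    ← Matrix.sum_sign_mul_det_mul_row]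
  simp only [Matrix.transpose_apply, Matrix.of_apply, mul_comm]
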